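/- arXiv:1604.00779 — 2 statements merged into one kernel-verified Lean document; each statement's English description precedes it below -/
import Mathlib

section
/- Let α ≥ 0, β > 0 and f(k) = k/2 + (α/2)·k/log(k ∨ e) + β. Then for every k ∈ ℕ₀ there exist constants C = C(k) > 0 and C' = C'(k) > 0, depending only on k, α and β, such that for every degree evolution (Z[m,n])_{n≥m} with attachment rule f started at k, and all pairs m ≤ n with f(Z[m,l])/l ≤ 1 almost surely for m ≤ l < n: E f(Z[m,n]) ≤ C·√(n/m)·(1 ∨ log(n/m))^α and E f(Z[m,n])² ≤ C'·(n/m)·(1 ∨ log(n/m))^{2α}. -/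
open MeasureTheory

/-- The attachment rule `f(k) = k/2 + (α/2)·k/log(k ∨ e) + β`. -/
noncomputable def fPA (α β : ℝ) (k : ℕ) : ℝ :=
  (k : ℝ) / 2 + α / 2 * (k : ℝ) / Real.log (max (k : ℝ) (Real.exp 1)) + β

/-- A degree evolution with attachment rule `f`, started at time `m` in state `k`:
a Markov chain on `ℕ` with increments in `{0,1}` and conditional jump probability
`f(Z[m,n])/n` given the past. -/
structure DegreeEvolution {Ω : Type} [MeasurableSpace Ω] (μ : Measure Ω)
    (f : ℕ → ℝ) (m k : ℕ) (Z : ℕ → Ω → ℕ) : Prop where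
  measurable : ∀ n, Measurable (Z n)
  init : ∀ ω, Z m ω = k
  incr : ∀ n, m ≤ n → ∀ ω, Z (n + 1) ω = Z n ω ∨ Z (n + 1) ω = Z n ω + 1
  jump : ∀ n, m ≤ n → ∀ h : ℕ → ℕ,
    μ ({ω | Z (n + 1) ω = Z n ω + 1} ∩ {ω | ∀ i, m ≤ i → i ≤ n → Z i ω = h i})
      = ENNReal.ofReal (f (h n) / (n : ℝ)) * μ {ω | ∀ i, m ≤ i → i ≤ n → Z i ω = h i}

open scoped ENNReal

lemma log_max_natCast_pos (j : ℕ) : 1 ≤ Real.log (max (j : ℝ) (Real.exp 1)) := by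
  rw [Real.le_log_iff_exp_le (lt_max_of_lt_right (Real.exp_pos 1))]
  exact le_max_right _ _

lemma fPA_pos {α β : ℝ} (hα : 0 ≤ α) (hβ : 0 < β) (j : ℕ) : 0 < fPA α β j := by
  have h1 := log_max_natCast_pos j
  unfold fPA
  positivity

lemma fPA_le {α β : ℝ} (hα : 0 ≤ α) (hβ : 0 < β) (j : ℕ) :
    fPA α β j ≤ (1 / 2 + α / 2 + β) * (j + 1) := by
  have h2 : α / 2 * (j : ℝ) / Real.log (max (j : ℝ) (Real.exp 1)) ≤ α / 2 * j :=
    div_le_self (by positivity) (log_max_natCast_pos j)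
  unfold fPA
  nlinarith [(Nat.cast_nonneg j : (0 : ℝ) ≤ j)]

/-- For `3 ≤ j` the cut-off in the attachment rule is inactive. -/
lemma fPA_eq_of_three_le (α β : ℝ) {j : ℕ} (hj : 3 ≤ j) :
    fPA α β j = (j : ℝ) / 2 + α / 2 * (j : ℝ) / Real.log j + β := by
  have h3 : (3 : ℝ) ≤ j := by exact_mod_cast hj
  unfold fPA
  rw [max_eq_left (by linarith [Real.exp_one_lt_d9])]

/-- The Lyapunov function `∏ i < j, (1 + 2 / f i)`, whose expectation along the chain grows by
the factor `1 + 2 / l` at time `l`. -/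
noncomputable def lyapunovPA (α β : ℝ) (j : ℕ) : ℝ :=
  ∏ i ∈ Finset.range j, (1 + 2 / fPA α β i)

lemma lyapunovPA_succ (α β : ℝ) (j : ℕ) :
    lyapunovPA α β (j + 1) = lyapunovPA α β j * (1 + 2 / fPA α β j) :=
  Finset.prod_range_succ _ _

lemma lyapunovPA_pos {α β : ℝ} (hα : 0 ≤ α) (hβ : 0 < β) (j : ℕ) : 0 < lyapunovPA α β j :=
  Finset.prod_pos fun i _ => by have := fPA_pos hα hβ i; positivity

lemma two_div_fPA_sub_le_log {α β : ℝ} (hα : 0 ≤ α) (hβ : 0 < β) {j : ℕ} (hj : 3 ≤ j) :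
    4 / (j : ℝ) - 4 * α / (j * Real.log j) - (8 + 8 * β) / (j : ℝ) ^ 2
      ≤ Real.log (1 + 2 / fPA α β j) := by
  have h3 : (3 : ℝ) ≤ j := by exact_mod_cast hj
  have hf := fPA_pos hα hβ j
  have hl : 0 < Real.log j := Real.log_pos (by linarith)
  set y : ℝ := α / Real.log j + 2 * β / j with hy
  have hy0 : 0 ≤ y := by positivity
  have hfy : fPA α β j = (j : ℝ) / 2 * (1 + y) := by
    rw [fPA_eq_of_three_le α β hj, hy]
    field_simp
    ring
  have hx : 2 / fPA α β j = 4 / (j : ℝ) * (1 / (1 + y)) := by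
    rw [hfy]; field_simp; norm_num
  have hinv : 1 - y ≤ 1 / (1 + y) := by
    rw [le_div_iff₀ (by linarith)]; nlinarith
  have hinv1 : 1 / (1 + y) ≤ 1 := by
    rw [div_le_one (by linarith)]; linarith
  have hlower : 4 / (j : ℝ) * (1 - y) ≤ 2 / fPA α β j := by
    rw [hx]; gcongr
  have hupper : 2 / fPA α β j ≤ 4 / (j : ℝ) := by
    rw [hx]; exact mul_le_of_le_one_right (by positivity) hinv1
  have hpos : 0 ≤ 2 / fPA α β j := by positivity
  have hsq : (2 / fPA α β j) ^ 2 ≤ 16 / (j : ℝ) ^ 2 := by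
    calc (2 / fPA α β j) ^ 2 ≤ (4 / (j : ℝ)) ^ 2 := by gcongr
      _ = 16 / (j : ℝ) ^ 2 := by rw [div_pow]; norm_num
  have hlog : ∀ x : ℝ, 0 ≤ x → x - x ^ 2 / 2 ≤ Real.log (1 + x) := by
    intro x hx0
    refine le_trans ?_ (Real.le_log_one_add_of_nonneg hx0)
    rw [le_div_iff₀ (by linarith)]
    nlinarith [pow_nonneg hx0 3]
  have := hlog _ hpos
  have he : 4 / (j : ℝ) * (1 - y)
      = 4 / (j : ℝ) - 4 * α / (j * Real.log j) - 8 * β / (j : ℝ) ^ 2 := by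
    rw [hy]; field_simp; ring
  have he2 : (8 + 8 * β) / (j : ℝ) ^ 2 = 16 / (j : ℝ) ^ 2 / 2 + 8 * β / (j : ℝ) ^ 2 := by ring
  linarith

/-- A lower bound for the reciprocal of `j log j` by increments of `log log`. -/
lemma one_div_mul_log_le_log_log_sub {x : ℝ} (hx : 3 ≤ x) :
    1 / (x * Real.log x) ≤ Real.log (Real.log x) - Real.log (Real.log (x - 1)) := by
  have hl : 0 < Real.log x := Real.log_pos (by linarith)
  have hl1 : 0 < Real.log (x - 1) := Real.log_pos (by linarith)
  have h1 : 1 / x ≤ Real.log x - Real.log (x - 1) := by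
    have := Real.one_sub_inv_le_log_of_pos (x := x / (x - 1)) (by apply div_pos <;> linarith)
    rw [Real.log_div (by linarith) (by linarith), inv_div] at this
    refine le_trans (le_of_eq ?_) this
    field_simp
    ring
  have h2 := Real.one_sub_inv_le_log_of_pos (div_pos hl hl1)
  rw [Real.log_div hl.ne' hl1.ne', inv_div] at h2
  refine le_trans ?_ h2
  rw [one_sub_div hl.ne', ← div_div]
  gcongr

lemma exists_pow_four_le_lyapunovPA {α β : ℝ} (hα : 0 ≤ α) (hβ : 0 < β) :
    ∃ a : ℝ, 0 < a ∧ ∀ j : ℕ, 3 ≤ j →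
      a * ((j : ℝ) ^ 4 / Real.log j ^ (4 * α)) ≤ lyapunovPA α β j := by
  let H : ℕ → ℝ := fun j =>
    4 * Real.log j - 4 * α * Real.log (Real.log (j - 1)) + (8 + 8 * β) / ((j : ℝ) - 1)
  have step : ∀ j : ℕ, 3 ≤ j → H (j + 1) - H j ≤ Real.log (1 + 2 / fPA α β j) := by
    intro j hj
    have h3 : (3 : ℝ) ≤ j := by exact_mod_cast hj
    refine le_trans ?_ (two_div_fPA_sub_le_log hα hβ hj)
    have h1 : Real.log ((j : ℝ) + 1) - Real.log j ≤ 1 / j := by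
      have := Real.log_le_sub_one_of_pos (x := ((j : ℝ) + 1) / j) (by positivity)
      rw [Real.log_div (by linarith) (by linarith)] at this
      refine this.trans (le_of_eq ?_)
      field_simp
      ring
    have h2 := one_div_mul_log_le_log_log_sub h3
    have h4 : (8 + 8 * β) / (j : ℝ) - (8 + 8 * β) / ((j : ℝ) - 1) ≤ -((8 + 8 * β) / (j : ℝ) ^ 2) := by
      have e : (8 + 8 * β) / (j : ℝ) - (8 + 8 * β) / ((j : ℝ) - 1)
          = -((8 + 8 * β) / ((j : ℝ) * (j - 1))) := by
        have : (j : ℝ) - 1 ≠ 0 := by linarith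
        field_simp
        ring
      rw [e, neg_le_neg_iff]
      apply div_le_div_of_nonneg_left (by positivity)
      · apply mul_pos <;> linarith
      · nlinarith
    have h5 := mul_le_mul_of_nonneg_left h2 (by positivity : 0 ≤ 4 * α)
    have e5 : 4 * α * (1 / ((j : ℝ) * Real.log j)) = 4 * α / (j * Real.log j) := by ring
    have e6 : 4 / (j : ℝ) = 4 * (1 / j) := by ring
    simp only [H]
    push_cast
    rw [add_sub_cancel_right, e6]
    linarith
  have key : ∀ j : ℕ, 3 ≤ j →
      lyapunovPA α β 3 * Real.exp (H j - H 3) ≤ lyapunovPA α β j := by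
    intro j hj
    induction j, hj using Nat.le_induction with
    | base => simp
    | succ j hj ih =>
      have hf := fPA_pos hα hβ j
      rw [lyapunovPA_succ α β j]
      have e : Real.exp (H (j + 1) - H 3)
          = Real.exp (H j - H 3) * Real.exp (H (j + 1) - H j) := by
        rw [← Real.exp_add]; ring_nf
      have hs : Real.exp (H (j + 1) - H j) ≤ 1 + 2 / fPA α β j :=
        (Real.le_log_iff_exp_le (by positivity)).1 (step j hj)
      rw [e, ← mul_assoc]
      exact mul_le_mul ih hs (Real.exp_pos _).le (lyapunovPA_pos hα hβ j).le
  refine ⟨lyapunovPA α β 3 * Real.exp (-H 3),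
    mul_pos (lyapunovPA_pos hα hβ 3) (Real.exp_pos _), fun j hj => (le_trans ?_ (key j hj))⟩
  have h3 : (3 : ℝ) ≤ j := by exact_mod_cast hj
  have hl : 0 < Real.log j := Real.log_pos (by linarith)
  have hl1 : 0 < Real.log ((j : ℝ) - 1) := Real.log_pos (by linarith)
  rw [sub_eq_neg_add, Real.exp_add, ← mul_assoc]
  refine mul_le_mul_of_nonneg_left ?_
    (mul_nonneg (lyapunovPA_pos hα hβ 3).le (Real.exp_pos _).le)
  have hj4 : (j : ℝ) ^ 4 = Real.exp (4 * Real.log j) := by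
    rw [← Real.log_rpow (by linarith), Real.exp_log (by positivity)]
    norm_cast
  rw [Real.rpow_def_of_pos hl, hj4, ← Real.exp_sub, Real.exp_le_exp]
  have hll : Real.log (Real.log ((j : ℝ) - 1)) ≤ Real.log (Real.log j) :=
    Real.log_le_log hl1 (Real.log_le_log (by linarith) (by linarith))
  have hK : 0 ≤ (8 + 8 * β) / ((j : ℝ) - 1) := div_nonneg (by linarith) (by linarith)
  simp only [H]
  nlinarith

lemma exists_rpow_le_mul_exp (p : ℝ) :
    ∃ M : ℝ, 1 ≤ M ∧ ∀ x : ℝ, 1 ≤ x → x ^ p ≤ M * Real.exp x := by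
  refine ⟨(⌈p⌉₊.factorial : ℝ), by exact_mod_cast Nat.factorial_pos _, fun x hx => ?_⟩
  calc x ^ p ≤ x ^ ((⌈p⌉₊ : ℕ) : ℝ) := Real.rpow_le_rpow_of_exponent_le hx (Nat.le_ceil p)
    _ = x ^ ⌈p⌉₊ := Real.rpow_natCast _ _
    _ ≤ _ := by
      have := Real.pow_div_factorial_le_exp x (by linarith) ⌈p⌉₊
      rwa [div_le_iff₀' (by positivity)] at this

/-- If `E[x⁴ / log⁴ᵅ x]` is of order `R²`, then this bounds `E[x²]` by `R (1 ∨ log R)²ᵅ`. -/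
lemma exists_sq_le_mul_one_add {α : ℝ} (hα : 0 ≤ α) :
    ∃ M : ℝ, 1 ≤ M ∧ ∀ x R : ℝ, 3 ≤ x → 1 ≤ R →
      x ^ 2 ≤ M * (R * (max 1 (Real.log R)) ^ (2 * α)
        * (1 + x ^ 4 / Real.log x ^ (4 * α) / R ^ 2)) := by
  obtain ⟨M, hM1, hM⟩ := exists_rpow_le_mul_exp (4 * α)
  refine ⟨M, hM1, fun x R hx hR => ?_⟩
  set Λ := max 1 (Real.log R) with hΛ
  set l := Real.log x with hl
  have hl1 : 1 ≤ l := by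
    rw [hl, Real.le_log_iff_exp_le (by linarith)]
    linarith [Real.exp_one_lt_d9]
  have hΛ1 : 1 ≤ Λ := le_max_left _ _
  have hΛp : 1 ≤ Λ ^ (2 * α) := Real.one_le_rpow hΛ1 (by positivity)
  have e4 : l ^ (4 * α) = (l ^ (2 * α)) ^ 2 := by
    rw [← Real.rpow_natCast, ← Real.rpow_mul (by linarith)]
    norm_num
    ring_nf
  rcases le_total l Λ with h | h
  · have hcmp : l ^ (2 * α) ≤ Λ ^ (2 * α) := Real.rpow_le_rpow (by linarith) h (by positivity)
    have hsq : x ^ 2 / (l ^ (2 * α) * R) ≤ 1 + x ^ 4 / l ^ (4 * α) / R ^ 2 := by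
      rw [e4]
      have : x ^ 4 / (l ^ (2 * α)) ^ 2 / R ^ 2 = (x ^ 2 / (l ^ (2 * α) * R)) ^ 2 := by
        field_simp
      rw [this]
      nlinarith [sq_nonneg (x ^ 2 / (l ^ (2 * α) * R) - 1)]
    calc x ^ 2 = R * l ^ (2 * α) * (x ^ 2 / (l ^ (2 * α) * R)) := by field_simp
      _ ≤ R * Λ ^ (2 * α) * (1 + x ^ 4 / l ^ (4 * α) / R ^ 2) := by gcongr
      _ ≤ _ := le_mul_of_one_le_left (by positivity) hM1
  · have hRx : R ≤ x := by
      rw [← Real.log_le_log_iff (by linarith) (by linarith)]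
      exact (le_max_right _ _).trans h
    have hlx : l ^ (4 * α) ≤ M * x := by
      have := hM l hl1
      rwa [hl, Real.exp_log (by linarith)] at this
    have h1 : x ^ 2 ≤ M * (R * 1 * (x ^ 4 / (M * x) / R ^ 2)) := by
      have : M * (R * 1 * (x ^ 4 / (M * x) / R ^ 2)) = x ^ 2 * (x / R) := by
        field_simp
      rw [this]
      exact le_mul_of_one_le_right (by positivity) ((one_le_div (by linarith)).2 hRx)
    refine h1.trans ?_
    have hlpos : 0 < l ^ (4 * α) := by positivity
    have : x ^ 4 / (M * x) / R ^ 2 ≤ 1 + x ^ 4 / l ^ (4 * α) / R ^ 2 := by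
      have : x ^ 4 / (M * x) / R ^ 2 ≤ x ^ 4 / l ^ (4 * α) / R ^ 2 := by gcongr
      linarith
    gcongr

lemma exists_fPA_sq_le {α β : ℝ} (hα : 0 ≤ α) (hβ : 0 < β) :
    ∃ D : ℝ, 0 < D ∧ ∀ (j : ℕ) (R : ℝ), 1 ≤ R →
      fPA α β j ^ 2 ≤ D * (R * (max 1 (Real.log R)) ^ (2 * α)
        * (1 + lyapunovPA α β j / R ^ 2)) := by
  obtain ⟨a, ha, hag⟩ := exists_pow_four_le_lyapunovPA hα hβ
  obtain ⟨M, hM1, hM⟩ := exists_sq_le_mul_one_add hα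
  set B : ℝ := 1 / 2 + α / 2 + β with hB
  have hB0 : 0 < B := by positivity
  refine ⟨9 * B ^ 2 * (M * (1 + 1 / a)), by positivity, fun j R hR => ?_⟩
  have hg := lyapunovPA_pos hα hβ j
  have hf := fPA_pos hα hβ j
  have hfB : fPA α β j ≤ B * (j + 1) := fPA_le hα hβ j
  have hΛp : 1 ≤ (max 1 (Real.log R)) ^ (2 * α) :=
    Real.one_le_rpow (le_max_left _ _) (by positivity)
  have hRΛ : 1 ≤ R * (max 1 (Real.log R)) ^ (2 * α) := one_le_mul_of_one_le_of_one_le hR hΛp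
  have ha1 : 1 ≤ 1 + 1 / a := by linarith [one_div_pos.2 ha]
  rw [mul_assoc]
  rcases Nat.lt_or_ge j 3 with hj | hj
  · have hj2 : (j : ℝ) ≤ 2 := by exact_mod_cast Nat.lt_succ_iff.1 hj
    calc fPA α β j ^ 2 ≤ (B * (2 + 1)) ^ 2 := by
          refine pow_le_pow_left₀ hf.le (hfB.trans ?_) 2
          gcongr
      _ = 9 * B ^ 2 * 1 := by ring
      _ ≤ _ := by
        refine mul_le_mul_of_nonneg_left ?_ (by positivity)
        refine one_le_mul_of_one_le_of_one_le (one_le_mul_of_one_le_of_one_le hM1 ha1)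
          (one_le_mul_of_one_le_of_one_le hRΛ ?_)
        have : 0 ≤ lyapunovPA α β j / R ^ 2 := by positivity
        linarith
  · have h3 : (3 : ℝ) ≤ j := by exact_mod_cast hj
    calc fPA α β j ^ 2 ≤ (B * (3 * j)) ^ 2 := by
          refine pow_le_pow_left₀ hf.le (hfB.trans ?_) 2
          gcongr
          linarith
      _ = 9 * B ^ 2 * (j : ℝ) ^ 2 := by ring
      _ ≤ _ := by
        refine mul_le_mul_of_nonneg_left ((hM j R h3 hR).trans ?_) (by positivity)
        rw [mul_assoc M]
        refine mul_le_mul_of_nonneg_left ?_ (by linarith)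
        rw [mul_left_comm (1 + 1 / a)]
        refine mul_le_mul_of_nonneg_left ?_ (by linarith)
        have h4 : (j : ℝ) ^ 4 / Real.log j ^ (4 * α) ≤ 1 / a * lyapunovPA α β j := by
          rw [one_div_mul_eq_div, le_div_iff₀' ha]
          exact hag j hj
        have h5 : (j : ℝ) ^ 4 / Real.log j ^ (4 * α) / R ^ 2
            ≤ 1 / a * (lyapunovPA α β j / R ^ 2) := by
          rw [← mul_div_assoc]
          gcongr
        have h6 : 0 ≤ lyapunovPA α β j / R ^ 2 := by positivity
        nlinarith [one_div_pos.2 ha]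

namespace DegreeEvolution

variable {Ω : Type} [MeasurableSpace Ω] {μ : Measure Ω} {f : ℕ → ℝ} {m k : ℕ} {Z : ℕ → Ω → ℕ}

lemma measurableSet_jump (hZ : DegreeEvolution μ f m k Z) (n : ℕ) :
    MeasurableSet {ω | Z (n + 1) ω = Z n ω + 1} :=
  measurableSet_eq_fun (hZ.measurable _) ((measurable_from_nat (f := (· + 1))).comp (hZ.measurable n))

/-- The jump rule, averaged over all histories. -/
lemma setLIntegral_jump (hZ : DegreeEvolution μ f m k Z) {n : ℕ} (hn : m ≤ n) (F : ℕ → ℝ≥0∞) :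
    ∫⁻ ω in {ω | Z (n + 1) ω = Z n ω + 1}, F (Z n ω) ∂μ
      = ∫⁻ ω, F (Z n ω) * ENNReal.ofReal (f (Z n ω) / n) ∂μ := by
  let S : Ω → (Finset.Icc m n → ℕ) := fun ω i => Z i ω
  have hS : Measurable S := measurable_pi_lambda _ fun i => hZ.measurable i
  let t : Finset.Icc m n := ⟨n, Finset.mem_Icc.2 ⟨hn, le_rfl⟩⟩
  have h1 : ∀ ν : Measure Ω, ∀ G : ℕ → ℝ≥0∞,
      ∫⁻ ω, G (Z n ω) ∂ν = ∑' s : Finset.Icc m n → ℕ, G (s t) * ν (S ⁻¹' {s}) := by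
    intro ν G
    have : ∫⁻ ω, G (Z n ω) ∂ν = ∫⁻ s, G (s t) ∂(ν.map S) := by
      rw [lintegral_map (Measurable.of_discrete) hS]
    rw [this, lintegral_countable']
    congr 1 with s
    rw [Measure.map_apply hS (measurableSet_singleton s)]
  rw [h1 _ F, h1 μ fun j => F j * ENNReal.ofReal (f j / n)]
  congr 1 with s
  rw [Measure.restrict_apply (hS (measurableSet_singleton s)), mul_assoc, Set.inter_comm]
  congr 1
  let h : ℕ → ℕ := fun i => if hi : i ∈ Finset.Icc m n then s ⟨i, hi⟩ else 0
  have hset : S ⁻¹' {s} = {ω | ∀ i, m ≤ i → i ≤ n → Z i ω = h i} := by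
    ext ω
    simp only [Set.mem_preimage, Set.mem_singleton_iff, Set.mem_ofPred_eq, funext_iff, S, h]
    constructor
    · intro H i hmi hin
      rw [dif_pos (Finset.mem_Icc.2 ⟨hmi, hin⟩)]
      exact H ⟨i, Finset.mem_Icc.2 ⟨hmi, hin⟩⟩
    · rintro H ⟨i, hi⟩
      have := H i (Finset.mem_Icc.1 hi).1 (Finset.mem_Icc.1 hi).2
      rwa [dif_pos hi] at this
  have ht : h n = s t := dif_pos t.2
  rw [hset, hZ.jump n hn h, ht]

end DegreeEvolution

section Lyapunov

variable {α β : ℝ} {Ω : Type} [MeasurableSpace Ω] {μ : Measure Ω} {m k : ℕ} {Z : ℕ → Ω → ℕ}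

lemma lintegral_lyapunovPA_succ (hα : 0 ≤ α) (hβ : 0 < β)
    (hZ : DegreeEvolution μ (fPA α β) m k Z) {n : ℕ} (hn : m ≤ n) :
    ∫⁻ ω, ENNReal.ofReal (lyapunovPA α β (Z (n + 1) ω)) ∂μ
      = ENNReal.ofReal (1 + 2 / n) * ∫⁻ ω, ENNReal.ofReal (lyapunovPA α β (Z n ω)) ∂μ := by
  set J := {ω | Z (n + 1) ω = Z n ω + 1} with hJ
  have hJm : MeasurableSet J := hZ.measurableSet_jump n
  let G : ℕ → ℝ≥0∞ := fun j => ENNReal.ofReal (lyapunovPA α β j)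
  let F : ℕ → ℝ≥0∞ := fun j => ENNReal.ofReal (lyapunovPA α β j * (2 / fPA α β j))
  have hm : ∀ H : ℕ → ℝ≥0∞, Measurable fun ω => H (Z n ω) := fun H =>
    (Measurable.of_discrete (f := H)).comp (hZ.measurable n)
  have hpt : ∀ ω, ENNReal.ofReal (lyapunovPA α β (Z (n + 1) ω))
      = G (Z n ω) + J.indicator (fun ω => F (Z n ω)) ω := by
    intro ω
    have hg := lyapunovPA_pos hα hβ (Z n ω)
    have hf := fPA_pos hα hβ (Z n ω)
    by_cases hω : ω ∈ J
    · rw [Set.indicator_of_mem hω, show Z (n + 1) ω = Z n ω + 1 from hω, lyapunovPA_succ,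
        mul_add, mul_one, ENNReal.ofReal_add hg.le (by positivity)]
    · rw [Set.indicator_of_notMem hω, (hZ.incr n hn ω).resolve_right hω, add_zero]
  simp_rw [hpt]
  rw [lintegral_add_left (hm G), lintegral_indicator hJm, hZ.setLIntegral_jump hn F,
    ENNReal.ofReal_add zero_le_one (by positivity), ENNReal.ofReal_one, add_mul, one_mul]
  congr 1
  rw [← lintegral_const_mul _ (hm G)]
  congr 1 with ω
  have hg := lyapunovPA_pos hα hβ (Z n ω)
  have hf := fPA_pos hα hβ (Z n ω)
  rw [← ENNReal.ofReal_mul (by positivity), ← ENNReal.ofReal_mul (by positivity)]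
  congr 1
  field_simp

lemma lintegral_lyapunovPA_le [IsProbabilityMeasure μ] (hα : 0 ≤ α) (hβ : 0 < β)
    (hZ : DegreeEvolution μ (fPA α β) m k Z) (hm : 1 ≤ m) {n : ℕ} (hn : m ≤ n) :
    ∫⁻ ω, ENNReal.ofReal (lyapunovPA α β (Z n ω)) ∂μ
      ≤ ENNReal.ofReal (lyapunovPA α β k * ((n : ℝ) / m) ^ 2) := by
  have hm0 : (0 : ℝ) < m := by exact_mod_cast hm
  have hg := lyapunovPA_pos hα hβ k
  induction n, hn using Nat.le_induction with
  | base => simp [hZ.init, hm0.ne']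
  | succ n hn ih =>
    have hn0 : (0 : ℝ) < n := by exact_mod_cast hm.trans hn
    rw [lintegral_lyapunovPA_succ hα hβ hZ hn]
    calc _ ≤ ENNReal.ofReal (1 + 2 / n) * ENNReal.ofReal (lyapunovPA α β k * ((n : ℝ) / m) ^ 2) := by
          gcongr
      _ = ENNReal.ofReal ((1 + 2 / n) * (lyapunovPA α β k * ((n : ℝ) / m) ^ 2)) :=
        (ENNReal.ofReal_mul (by positivity)).symm
      _ ≤ _ := by
        refine ENNReal.ofReal_le_ofReal ?_
        rw [mul_left_comm]
        refine mul_le_mul_of_nonneg_left ?_ hg.le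
        have e : (1 + 2 / (n : ℝ)) * ((n : ℝ) / m) ^ 2 = ((n : ℝ) ^ 2 + 2 * n) / m ^ 2 := by
          field_simp
        rw [e, div_pow]
        push_cast
        gcongr
        nlinarith

lemma integrable_lyapunovPA_and_integral_le [IsProbabilityMeasure μ] (hα : 0 ≤ α) (hβ : 0 < β)
    (hZ : DegreeEvolution μ (fPA α β) m k Z) (hm : 1 ≤ m) {n : ℕ} (hn : m ≤ n) :
    Integrable (fun ω => lyapunovPA α β (Z n ω)) μ ∧
      ∫ ω, lyapunovPA α β (Z n ω) ∂μ ≤ lyapunovPA α β k * ((n : ℝ) / m) ^ 2 := by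
  have hle := lintegral_lyapunovPA_le hα hβ hZ hm hn
  have hmeas : AEStronglyMeasurable (fun ω => lyapunovPA α β (Z n ω)) μ :=
    ((Measurable.of_discrete (f := lyapunovPA α β)).comp (hZ.measurable n)).aestronglyMeasurable
  have hnn : 0 ≤ᵐ[μ] fun ω => lyapunovPA α β (Z n ω) :=
    Filter.Eventually.of_forall fun ω => (lyapunovPA_pos hα hβ _).le
  have hg := lyapunovPA_pos hα hβ k
  refine ⟨⟨hmeas, ?_⟩, ?_⟩
  · rw [hasFiniteIntegral_iff_ofReal hnn]
    exact hle.trans_lt ENNReal.ofReal_lt_top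
  · rw [integral_eq_lintegral_of_nonneg_ae hnn hmeas]
    exact ENNReal.toReal_le_of_le_ofReal (by positivity) hle

end Lyapunov

theorem stmt5 (α β : ℝ) (hα : 0 ≤ α) (hβ : 0 < β) (k : ℕ) :
    ∃ C : ℝ, 0 < C ∧ ∃ C' : ℝ, 0 < C' ∧
      ∀ (Ω : Type) (_ : MeasurableSpace Ω) (μ : Measure Ω), IsProbabilityMeasure μ →
        ∀ m n : ℕ, 1 ≤ m → m ≤ n →
          ∀ Z : ℕ → Ω → ℕ, DegreeEvolution μ (fPA α β) m k Z →
            (∀ l, m ≤ l → l < n → ∀ᵐ ω ∂μ, fPA α β (Z l ω) ≤ (l : ℝ)) →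
              (∫ ω, fPA α β (Z n ω) ∂μ)
                  ≤ C * Real.sqrt ((n : ℝ) / (m : ℝ)) * (max 1 (Real.log ((n : ℝ) / (m : ℝ)))) ^ α
              ∧ (∫ ω, (fPA α β (Z n ω)) ^ 2 ∂μ)
                  ≤ C' * ((n : ℝ) / (m : ℝ)) * (max 1 (Real.log ((n : ℝ) / (m : ℝ)))) ^ (2 * α) := by
  obtain ⟨D, hD, hfD⟩ := exists_fPA_sq_le hα hβ
  have hg := lyapunovPA_pos hα hβ k
  refine ⟨D * (1 + lyapunovPA α β k) + 1, by positivity,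
    D * (1 + lyapunovPA α β k), by positivity, ?_⟩
  intro Ω _ μ _ m n hm hn Z hZ _
  obtain ⟨hint, hle⟩ := integrable_lyapunovPA_and_integral_le hα hβ hZ hm hn
  have hm0 : (0 : ℝ) < m := by exact_mod_cast hm
  set R : ℝ := (n : ℝ) / m with hR
  have hR1 : 1 ≤ R := (one_le_div hm0).2 (by exact_mod_cast hn)
  set Λ := max 1 (Real.log R) with hΛ
  have hΛ0 : 0 < Λ := lt_max_of_lt_left one_pos
  have hW : Integrable (fun ω => 1 + lyapunovPA α β (Z n ω) / R ^ 2) μ :=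
    (integrable_const 1).add (hint.div_const _)
  have hWle : ∫ ω, (1 + lyapunovPA α β (Z n ω) / R ^ 2) ∂μ ≤ 1 + lyapunovPA α β k := by
    rw [integral_add (integrable_const 1) (hint.div_const _), integral_div]
    simp only [integral_const, probReal_univ, smul_eq_mul, mul_one]
    gcongr
    exact (div_le_iff₀ (by positivity)).2 hle
  set s := Real.sqrt R * Λ ^ α with hs
  have hs0 : 0 < s := by positivity
  have hss : s ^ 2 = R * Λ ^ (2 * α) := by
    rw [hs, mul_pow, Real.sq_sqrt (by linarith), mul_comm 2 α, Real.rpow_mul hΛ0.le]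
    norm_cast
  have hsq : ∀ ω, fPA α β (Z n ω) ^ 2
      ≤ D * s ^ 2 * (1 + lyapunovPA α β (Z n ω) / R ^ 2) := fun ω => by
    rw [hss, mul_assoc]; exact hfD _ R hR1
  have hlin : ∀ ω, fPA α β (Z n ω)
      ≤ s * (D * (1 + lyapunovPA α β (Z n ω) / R ^ 2) + 1) := fun ω => by
    have h1 := hsq ω
    have hf := fPA_pos hα hβ (Z n ω)
    refine le_of_mul_le_mul_left ?_ hs0
    nlinarith [sq_nonneg (fPA α β (Z n ω) - s), mul_pos hs0 hf]
  constructor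
  · calc ∫ ω, fPA α β (Z n ω) ∂μ
        ≤ ∫ ω, s * (D * (1 + lyapunovPA α β (Z n ω) / R ^ 2) + 1) ∂μ :=
          integral_mono_of_nonneg (Filter.Eventually.of_forall fun ω => (fPA_pos hα hβ _).le)
            (((hW.const_mul D).add (integrable_const 1)).const_mul s)
            (Filter.Eventually.of_forall hlin)
      _ = s * (D * ∫ ω, (1 + lyapunovPA α β (Z n ω) / R ^ 2) ∂μ + 1) := by
          rw [integral_const_mul, integral_add (hW.const_mul D) (integrable_const 1),
            integral_const_mul]
          simp
      _ ≤ s * (D * (1 + lyapunovPA α β k) + 1) := by gcongr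
      _ = _ := by rw [hs]; ring
  · calc ∫ ω, fPA α β (Z n ω) ^ 2 ∂μ
        ≤ ∫ ω, D * s ^ 2 * (1 + lyapunovPA α β (Z n ω) / R ^ 2) ∂μ :=
          integral_mono_of_nonneg (Filter.Eventually.of_forall fun ω => sq_nonneg _)
            (hW.const_mul _) (Filter.Eventually.of_forall hsq)
      _ = D * s ^ 2 * ∫ ω, (1 + lyapunovPA α β (Z n ω) / R ^ 2) ∂μ := integral_const_mul _ _
      _ ≤ D * s ^ 2 * (1 + lyapunovPA α β k) := by gcongr
      _ = _ := by rw [hss]; ring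
end

section
/- Let f : ℕ₀ → (0,∞) and define Φ(x) = ∑_{i=0}^{x−1} 1/f(i) for x ∈ ℕ₀. Let m ∈ ℕ and let (Z[m,n])_{n≥m} be a degree evolution with attachment rule f started at 0, with f(Z[m,n])/n ≤ 1 almost surely for all n ≥ m. Then the process (Φ(Z[m,n]) − ∑_{i=m}^{n−1} 1/i)_{n≥m} is a martingale with respect to the natural filtration of (Z[m,n]). -/
open MeasureTheory

/-- The natural filtration of the process `(Z[m,m+n])_{n≥0}`. -/
def natFilt {Ω : Type} [mΩ : MeasurableSpace Ω] (Z : ℕ → Ω → ℕ)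
    (hZ : ∀ n, Measurable (Z n)) (m : ℕ) : Filtration ℕ mΩ where
  seq n := ⨆ i ∈ Set.Iic n, MeasurableSpace.comap (Z (m + i)) inferInstance
  mono' := fun a b hab => by
    refine biSup_mono fun i hi => ?_
    exact le_trans hi hab
  le' := fun n => by
    refine iSup₂_le fun i _ => ?_
    exact (hZ (m + i)).comap_le

namespace DegreeEvolution

variable {Ω : Type} [mΩ : MeasurableSpace Ω] {μ : Measure Ω} {f : ℕ → ℝ} {m k : ℕ} {Z : ℕ → Ω → ℕ}

theorem le_add (hZ : DegreeEvolution μ f m k Z) (n : ℕ) (ω : Ω) : Z (m + n) ω ≤ k + n := by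
  induction n with
  | zero => simp [hZ.init ω]
  | succ n ih =>
    have h := hZ.incr (m + n) (Nat.le_add_right m n) ω
    rw [← add_assoc]
    lia

/-- A function of the state at a fixed time is integrable, as the state is bounded. -/
theorem integrable_comp [IsFiniteMeasure μ] (hZ : DegreeEvolution μ f m k Z) (φ : ℕ → ℝ) (n : ℕ) :
    Integrable (fun ω => φ (Z (m + n) ω)) μ := by
  refine Integrable.of_bound (C := ∑ j ∈ Finset.range (k + n + 1), ‖φ j‖)
    ((measurable_from_nat (f := φ)).comp (hZ.measurable (m + n))).aestronglyMeasurable ?_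
  refine Filter.Eventually.of_forall fun ω => ?_
  exact Finset.single_le_sum (f := fun j => ‖φ j‖) (fun j _ => norm_nonneg _)
    (Finset.mem_range.2 (Nat.lt_succ_of_le (hZ.le_add n ω)))

/-- The trajectory up to step `n` after the starting time. -/
def path (Z : ℕ → Ω → ℕ) (m n : ℕ) (ω : Ω) : Fin (n + 1) → ℕ := fun i => Z (m + i) ω

theorem measurable_path (hZ : DegreeEvolution μ f m k Z) (n : ℕ) : Measurable (path Z m n) :=
  measurable_pi_lambda _ fun i => hZ.measurable (m + i)

theorem natFilt_le_comap_path (hZ : ∀ n, Measurable (Z n)) (n : ℕ) :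
    natFilt Z hZ m n ≤ MeasurableSpace.comap (path Z m n) inferInstance := by
  refine iSup₂_le fun i hi => ?_
  have h : Z (m + i) = (fun g : Fin (n + 1) → ℕ => g ⟨i, Nat.lt_succ_of_le hi⟩) ∘ path Z m n := rfl
  rw [h, ← MeasurableSpace.comap_comp]
  exact MeasurableSpace.comap_mono (measurable_pi_apply _).comap_le

theorem measureReal_jump_inter_path (hZ : DegreeEvolution μ f m k Z) (hf : ∀ i, 0 ≤ f i) (n : ℕ)
    (g : Fin (n + 1) → ℕ) :
    μ.real ({ω | Z (m + n + 1) ω = Z (m + n) ω + 1} ∩ path Z m n ⁻¹' {g})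
      = f (g (Fin.last n)) / ((m + n : ℕ) : ℝ) * μ.real (path Z m n ⁻¹' {g}) := by
  let h : ℕ → ℕ := fun i => g (Fin.ofNat (n + 1) (i - m))
  have hh : ∀ j : Fin (n + 1), h (m + j) = g j := fun j => by simp [h]
  have hset : {ω | ∀ i, m ≤ i → i ≤ m + n → Z i ω = h i} = path Z m n ⁻¹' {g} := by
    ext ω
    simp only [Set.mem_ofPred_eq, Set.mem_preimage, Set.mem_singleton_iff, funext_iff, path]
    constructor
    · intro H i
      rw [H (m + i) (by lia) (by lia), hh]
    · intro H i hmi hin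
      obtain ⟨j, rfl⟩ := Nat.exists_eq_add_of_le hmi
      exact (H ⟨j, by lia⟩).trans (hh ⟨j, by lia⟩).symm
  have hlast : h (m + n) = g (Fin.last n) := hh (Fin.last n)
  have hj := hZ.jump (m + n) (Nat.le_add_right m n) h
  rw [hset, hlast] at hj
  rw [measureReal_def, hj, ENNReal.toReal_mul,
    ENNReal.toReal_ofReal (div_nonneg (hf _) (Nat.cast_nonneg _)), measureReal_def]

end DegreeEvolution

theorem stmt7 {Ω : Type} [mΩ : MeasurableSpace Ω] (μ : Measure Ω) [IsProbabilityMeasure μ]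
    (f : ℕ → ℝ) (hfpos : ∀ i, 0 < f i) (m : ℕ) (hm : 1 ≤ m)
    (Z : ℕ → Ω → ℕ) (hZ : DegreeEvolution μ f m 0 Z)
    (hbd : ∀ n, m ≤ n → ∀ᵐ ω ∂μ, f (Z n ω) ≤ (n : ℝ)) :
    Martingale
      (fun n ω => (∑ i ∈ Finset.range (Z (m + n) ω), 1 / f i)
        - ∑ i ∈ Finset.Ico m (m + n), (1 : ℝ) / (i : ℝ))
      (natFilt Z hZ.measurable m) μ := by
  set M : ℕ → Ω → ℝ := fun n ω => (∑ i ∈ Finset.range (Z (m + n) ω), 1 / f i)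
    - ∑ i ∈ Finset.Ico m (m + n), (1 : ℝ) / (i : ℝ)
  have hint : ∀ n, Integrable (M n) μ := fun n =>
    (hZ.integrable_comp (fun z => ∑ i ∈ Finset.range z, 1 / f i) n).sub (integrable_const _)
  refine martingale_of_setIntegral_eq_succ (fun n => ?_) hint fun n s hs => ?_
  · have hmeas : Measurable[natFilt Z hZ.measurable m n] (Z (m + n)) :=
      Measurable.of_comap_le (le_iSup₂_of_le n (Set.mem_Iic.2 le_rfl) le_rfl)
    exact ((measurable_from_nat (f := fun z => ∑ i ∈ Finset.range z, 1 / f i)).comp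
      hmeas).stronglyMeasurable.sub stronglyMeasurable_const
  obtain ⟨S, -, rfl⟩ := DegreeEvolution.natFilt_le_comap_path hZ.measurable n s hs
  have hatom : ∀ g : Fin (n + 1) → ℕ, MeasurableSet (DegreeEvolution.path Z m n ⁻¹' {g}) :=
    fun g => hZ.measurable_path n (measurableSet_singleton g)
  have hunion : DegreeEvolution.path Z m n ⁻¹' S
      = ⋃ g : S, DegreeEvolution.path Z m n ⁻¹' {(g : Fin (n + 1) → ℕ)} := by
    ext ω
    simp
  have hdisj : Pairwise (Function.onFun Disjoint
      fun g : S => DegreeEvolution.path Z m n ⁻¹' {(g : Fin (n + 1) → ℕ)}) := fun a b hab =>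
    Disjoint.preimage _ (Set.disjoint_singleton.2 fun h => hab (Subtype.ext h))
  rw [hunion, integral_iUnion (fun g : S => hatom g) hdisj (hint n).integrableOn,
    integral_iUnion (fun g : S => hatom g) hdisj (hint (n + 1)).integrableOn]
  refine tsum_congr fun ⟨g, _⟩ => ?_
  let J : Set Ω := {ω | Z (m + n + 1) ω = Z (m + n) ω + 1}
  have hJ : MeasurableSet J := measurableSet_eq_fun (hZ.measurable _)
    ((hZ.measurable _).add_const 1)
  have hstep : ∀ ω ∈ DegreeEvolution.path Z m n ⁻¹' {g}, M (n + 1) ω - M n ω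
      = J.indicator (fun _ => 1 / f (g (Fin.last n))) ω - 1 / ((m + n : ℕ) : ℝ) := by
    intro ω hω
    have hg : Z (m + n) ω = g (Fin.last n) := congrFun hω (Fin.last n)
    have hIco := Finset.sum_Ico_succ_top (Nat.le_add_right m n) fun i : ℕ => (1 : ℝ) / (i : ℝ)
    simp only [M, ← add_assoc]
    rw [hIco]
    rcases hZ.incr (m + n) (Nat.le_add_right m n) ω with h | h
    · have hn : ω ∉ J := fun h' : Z (m + n + 1) ω = Z (m + n) ω + 1 => by lia
      rw [Set.indicator_of_notMem hn, h]
      ring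
    · have hy : ω ∈ J := h
      rw [Set.indicator_of_mem hy, h, Finset.sum_range_succ, hg]
      ring
  rw [eq_comm, ← sub_eq_zero,
    ← integral_sub (hint (n + 1)).integrableOn (hint n).integrableOn,
    setIntegral_congr_fun (hatom g) hstep,
    integral_sub ((integrable_const _).indicator hJ) (integrable_const _),
    integral_indicator_const _ hJ, integral_const, measureReal_restrict_apply hJ,
    measureReal_restrict_apply_univ, hZ.measureReal_jump_inter_path (fun i => (hfpos i).le) n g]
  have hf := (hfpos (g (Fin.last n))).ne'
  simp only [smul_eq_mul]
  field_simp
  ring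
end
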